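/- arXiv:1507.03238 — 10 statements merged into one kernel-verified Lean document; each statement's English description precedes it below -/
import Mathlib

section
/- Let N ≥ 1 and let c₀₁ and c_{02,k}, c_{03,k}, c_{12,k}, c_{13,k}, c_{23,k} (k ∈ ℤ/N) be complex numbers satisfying the Ptolemy relations c_{03,k}·c_{12,k} + c₀₁·c_{23,k} = c_{02,k}·c_{13,k} and the identification relations c_{12,k} = c_{13,k−1} and c_{02,k} = c_{03,k−1} for all k (indices mod N), and suppose c_{02,k}, c_{03,k}, c_{12,k}, c_{13,k} are all nonzero. Then ∑_{k=0}^{N−1} c_{23,k}/(c_{12,k}·c_{13,k}) = 0 if and only if ∑_{k=0}^{N−1} c_{23,k}/(c_{02,k}·c_{03,k}) = 0. -/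
/-- The backward differences of a function on `ZMod N` sum to zero. -/
theorem ZMod.sum_sub_one_sub_self {N : ℕ} [NeZero N] {A : Type*} [AddCommGroup A]
    (f : ZMod N → A) : ∑ k, (f (k - 1) - f k) = 0 := by
  rw [Finset.sum_sub_distrib, sub_eq_zero]
  exact (Equiv.subRight (1 : ZMod N)).sum_comp f

/-- A function on `ZMod N` invariant under translation by one is constant. -/
theorem ZMod.eq_apply_zero_of_apply_sub_one {N : ℕ} [NeZero N] {A : Type*} {f : ZMod N → A}
    (hf : ∀ k, f (k - 1) = f k) (k : ZMod N) : f k = f 0 := by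
  have h : ∀ n : ℕ, f n = f 0 := fun n => by
    induction n with
    | zero => simp
    | succ n ih => rw [← hf, ← ih]; simp
  simpa using h k.val

/-- **Edge relation equivalence** (Lemma on Ptolemy assignments on the cyclic complex `K`).
For a Ptolemy assignment on the complex obtained by cyclically gluing `N` ordered simplices
along a common `01`-edge (with Ptolemy coordinate `c01`), where the top and bottom Ptolemy
coordinates are nonzero, the two edge relations around the center edge are equivalent. -/
theorem edge_relations_equivalent (N : ℕ) [NeZero N]
    (c01 : ℂ) (c02 c03 c12 c13 c23 : ZMod N → ℂ)
    (hPt : ∀ k, c03 k * c12 k + c01 * c23 k = c02 k * c13 k)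
    (hid12 : ∀ k, c12 k = c13 (k - 1))
    (hid02 : ∀ k, c02 k = c03 (k - 1))
    (h02 : ∀ k, c02 k ≠ 0) (h03 : ∀ k, c03 k ≠ 0)
    (h12 : ∀ k, c12 k ≠ 0) (h13 : ∀ k, c13 k ≠ 0) :
    (∑ k : ZMod N, c23 k / (c12 k * c13 k)) = 0 ↔
      (∑ k : ZMod N, c23 k / (c02 k * c03 k)) = 0 := by
  rcases eq_or_ne c01 0 with rfl | h01
  · have hconst := ZMod.eq_apply_zero_of_apply_sub_one (f := fun k => c03 k / c13 k) fun k => by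
      simp only [← hid12, ← hid02]
      rw [div_eq_div_iff (h12 k) (h13 k)]
      linear_combination -hPt k
    have hr : c03 0 / c13 0 ≠ 0 := div_ne_zero (h03 0) (h13 0)
    generalize c03 0 / c13 0 = r at hconst hr
    have h3 : ∀ k, c03 k = r * c13 k := fun k => (div_eq_iff (h13 k)).1 (hconst k)
    have h2 : ∀ k, c02 k = r * c12 k := fun k => by rw [hid02, hid12, h3]
    have hsum : ∑ k, c23 k / (c12 k * c13 k) = r ^ 2 * ∑ k, c23 k / (c02 k * c03 k) := by
      rw [Finset.mul_sum]
      refine Finset.sum_congr rfl fun k _ => ?_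
      have := h12 k
      have := h13 k
      rw [h2, h3]
      field_simp
    rw [hsum, mul_eq_zero, or_iff_right (pow_ne_zero 2 hr)]
  · have htop : c01 * ∑ k, c23 k / (c12 k * c13 k) = 0 := by
      rw [Finset.mul_sum, ← ZMod.sum_sub_one_sub_self fun k => c03 k / c13 k]
      refine Finset.sum_congr rfl fun k _ => ?_
      have := h12 k
      have := h13 k
      rw [← hid12, ← hid02]
      field_simp
      linear_combination hPt k
    have hbot : c01 * ∑ k, c23 k / (c02 k * c03 k) = 0 := by
      rw [Finset.mul_sum, ← neg_zero, ← ZMod.sum_sub_one_sub_self fun k => c13 k / c03 k,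
        ← Finset.sum_neg_distrib]
      refine Finset.sum_congr rfl fun k _ => ?_
      have := h02 k
      have := h03 k
      rw [← hid12, ← hid02]
      field_simp
      linear_combination hPt k
    exact iff_of_true ((mul_eq_zero.1 htop).resolve_left h01)
      ((mul_eq_zero.1 hbot).resolve_left h01)
end

section
/- Let N ≥ 1 and let c₀₁ and c_{02,k}, c_{03,k}, c_{12,k}, c_{13,k}, c_{23,k} (k ∈ ℤ/N) be complex numbers satisfying the Ptolemy relations c_{03,k}·c_{12,k} + c₀₁·c_{23,k} = c_{02,k}·c_{13,k} and the identification relations c_{12,k} = c_{13,k−1} and c_{02,k} = c_{03,k−1} for all k (indices mod N), and suppose c_{02,k}, c_{03,k}, c_{12,k}, c_{13,k} are all nonzero. If moreover c₀₁ ≠ 0, then both ∑_{k=0}^{N−1} c_{23,k}/(c_{12,k}·c_{13,k}) = 0 and ∑_{k=0}^{N−1} c_{23,k}/(c_{02,k}·c_{03,k}) = 0. -/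
/-- A cyclic difference sums to zero over a finite additive group. -/
theorem sum_sub_comp_sub_right_eq_zero {G M : Type*} [AddGroup G] [Fintype G] [AddCommGroup M]
    (f : G → M) (a : G) : ∑ k, (f k - f (k - a)) = 0 := by
  rw [Finset.sum_sub_distrib, sub_eq_zero]
  exact ((Equiv.subRight a).sum_comp f).symm

/-- If moreover the Ptolemy coordinate `c01` of the center edge is nonzero, then both edge
relations around the center edge of the cyclic complex `K` are satisfied. -/
theorem edge_relations_of_center_nonzero (N : ℕ) [NeZero N]
    (c01 : ℂ) (c02 c03 c12 c13 c23 : ZMod N → ℂ)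
    (hPt : ∀ k, c03 k * c12 k + c01 * c23 k = c02 k * c13 k)
    (hid12 : ∀ k, c12 k = c13 (k - 1))
    (hid02 : ∀ k, c02 k = c03 (k - 1))
    (h02 : ∀ k, c02 k ≠ 0) (h03 : ∀ k, c03 k ≠ 0)
    (h12 : ∀ k, c12 k ≠ 0) (h13 : ∀ k, c13 k ≠ 0)
    (hc01 : c01 ≠ 0) :
    (∑ k : ZMod N, c23 k / (c12 k * c13 k)) = 0 ∧
      (∑ k : ZMod N, c23 k / (c02 k * c03 k)) = 0 := by
  constructor
  · rw [← mul_right_inj' (neg_ne_zero.mpr hc01), mul_zero, Finset.mul_sum,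
      ← sum_sub_comp_sub_right_eq_zero (fun k => c03 k / c13 k) 1]
    refine Finset.sum_congr rfl fun k _ => ?_
    rw [← hid12, ← hid02]
    have := h12 k
    have := h13 k
    field_simp
    linear_combination -hPt k
  · rw [← mul_right_inj' hc01, mul_zero, Finset.mul_sum,
      ← sum_sub_comp_sub_right_eq_zero (fun k => c13 k / c03 k) 1]
    refine Finset.sum_congr rfl fun k _ => ?_
    rw [← hid12, ← hid02]
    have := h02 k
    have := h03 k
    field_simp
    linear_combination hPt k
end

section
/- Let N ≥ 1 and let c₀₁ and c_{02,k}, c_{03,k}, c_{12,k}, c_{13,k}, c_{23,k} (k ∈ ℤ/N) be complex numbers satisfying the Ptolemy relations c_{03,k}·c_{12,k} + c₀₁·c_{23,k} = c_{02,k}·c_{13,k} and the identification relations c_{12,k} = c_{13,k−1} and c_{02,k} = c_{03,k−1} for all k (indices mod N), and suppose c_{02,k}, c_{03,k}, c_{12,k}, c_{13,k} are all nonzero. Then c₀₁ · ∑_{k=0}^{N−1} c_{23,k}/(c_{12,k}·c_{13,k}) = 0 and c₀₁ · ∑_{k=0}^{N−1} c_{23,k}/(c_{02,k}·c_{03,k})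 = 0 (with no assumption that c₀₁ is nonzero). -/
/-- A sum of consecutive differences around the cycle `ZMod N` vanishes. -/
theorem sum_sub_shift_eq_zero {N : ℕ} [NeZero N] {A : Type*} [AddCommGroup A] (g : ZMod N → A) :
    ∑ k : ZMod N, (g k - g (k - 1)) = 0 := by
  rw [Finset.sum_sub_distrib, sub_eq_zero]
  exact ((Equiv.subRight (1 : ZMod N)).sum_comp g).symm

/-- The telescoping identity underlying the edge relations: with no assumption on `c01`,
the products `c01 * (edge relation sums)` always vanish. -/
theorem center_times_edge_relations_eq_zero (N : ℕ) [NeZero N]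
    (c01 : ℂ) (c02 c03 c12 c13 c23 : ZMod N → ℂ)
    (hPt : ∀ k, c03 k * c12 k + c01 * c23 k = c02 k * c13 k)
    (hid12 : ∀ k, c12 k = c13 (k - 1))
    (hid02 : ∀ k, c02 k = c03 (k - 1))
    (h02 : ∀ k, c02 k ≠ 0) (h03 : ∀ k, c03 k ≠ 0)
    (h12 : ∀ k, c12 k ≠ 0) (h13 : ∀ k, c13 k ≠ 0) :
    c01 * (∑ k : ZMod N, c23 k / (c12 k * c13 k)) = 0 ∧
      c01 * (∑ k : ZMod N, c23 k / (c02 k * c03 k)) = 0 := by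
  constructor
  · rw [← neg_eq_zero, Finset.mul_sum, ← Finset.sum_neg_distrib,
      ← sum_sub_shift_eq_zero fun k => c03 k / c13 k]
    refine Finset.sum_congr rfl fun k _ => ?_
    rw [← hid12, ← hid02]
    field_simp [h12 k, h13 k]
    linear_combination -hPt k
  · rw [Finset.mul_sum, ← sum_sub_shift_eq_zero fun k => c13 k / c03 k]
    refine Finset.sum_congr rfl fun k _ => ?_
    rw [← hid12, ← hid02]
    field_simp [h02 k, h03 k]
    linear_combination hPt k
end

section
/- Let N ≥ 1 and let t_k, b_k, h_k be nonzero complex numbers and c_{01,k}, c_{02,k}, c_{03,k}, c_{12,k}, c_{13,k}, c_{23,k} complex numbers (k ∈ ℤ/N, indices mod N) satisfying the Ptolemy relations c_{03,k}·c_{12,k} + c_{01,k}·c_{23,k} = c_{02,k}·c_{13,k} and the enhanced identification relations c_{12,k} = t_k·h_k·c_{13,k−1}, c_{02,k} = b_k·h_k·c_{03,k−1}, and c_{01,k} = c_{01,k−1}·t_k·b_k for all k, with c_{02,k}, c_{03,k}, c_{12,k}, c_{13,k} all nonzero. Then ∑_{k=0}^{N−1} (c_{23,k}/(c_{12,k}·c_{13,k}))·∏_{j=1}^{k}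 t_j² = 0 if and only if ∑_{k=0}^{N−1} (c_{23,k}/(c_{02,k}·c_{03,k}))·∏_{j=1}^{k} b_j² = 0. -/
section EdgeRelation

variable {F : Type*} [Field F] {N : ℕ} {t b c01 c02 c03 c12 c13 c23 : ZMod N → F}

/-- The coordinate of the center edge changes by the accumulated twisting factors. -/
lemma center_coordinate_eq (hid01 : ∀ k, c01 k = c01 (k - 1) * t k * b k) (m : ℕ) :
    c01 (m : ZMod N) = c01 0 * (∏ j ∈ Finset.Icc 1 m, t (j : ZMod N)) *
      ∏ j ∈ Finset.Icc 1 m, b (j : ZMod N) := by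
  induction m with
  | zero => simp
  | succ m ih =>
    rw [hid01, Finset.prod_Icc_succ_top (by omega), Finset.prod_Icc_succ_top (by omega)]
    have hm : ((m + 1 : ℕ) : ZMod N) - 1 = m := by push_cast; ring
    rw [hm, ih]
    ring

/-- The partial sums of the edge relation, scaled by the center coordinate, telescope. -/
lemma center_mul_partial_sum (ht : ∀ k, t k ≠ 0) (hb : ∀ k, b k ≠ 0)
    (hPt : ∀ k, c03 k * c12 k + c01 k * c23 k = c02 k * c13 k)
    (hcross : ∀ k, t k * c02 k * c13 (k - 1) = b k * c12 k * c03 (k - 1))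
    (hid01 : ∀ k, c01 k = c01 (k - 1) * t k * b k)
    (h12 : ∀ k, c12 k ≠ 0) (h13 : ∀ k, c13 k ≠ 0) (m : ℕ) :
    c01 0 * ∑ k ∈ Finset.range (m + 1),
        (c23 (k : ZMod N) / (c12 (k : ZMod N) * c13 (k : ZMod N))) *
          ∏ j ∈ Finset.Icc 1 k, (t (j : ZMod N)) ^ 2 =
      c02 0 / c12 0 - c03 (m : ZMod N) / c13 (m : ZMod N) *
        ((∏ j ∈ Finset.Icc 1 m, t (j : ZMod N)) / ∏ j ∈ Finset.Icc 1 m, b (j : ZMod N)) := by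
  induction m with
  | zero =>
    have h0 := hPt 0
    have := h12 0
    have := h13 0
    simp
    field_simp
    linear_combination h0
  | succ m ih =>
    rw [Finset.sum_range_succ, mul_add, ih, Finset.prod_pow]
    have hm : ((m + 1 : ℕ) : ZMod N) - 1 = m := by push_cast; ring
    have hc := center_coordinate_eq hid01 (m + 1)
    have hP := hPt (m + 1 : ℕ)
    have hx := hcross (m + 1 : ℕ)
    rw [hm] at hx
    rw [Finset.prod_Icc_succ_top (by omega), Finset.prod_Icc_succ_top (by omega)] at *
    have hT : ∏ j ∈ Finset.Icc 1 m, t (j : ZMod N) ≠ 0 :=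
      Finset.prod_ne_zero_iff.mpr fun j _ => ht j
    have hB : ∏ j ∈ Finset.Icc 1 m, b (j : ZMod N) ≠ 0 :=
      Finset.prod_ne_zero_iff.mpr fun j _ => hb j
    generalize ∏ j ∈ Finset.Icc 1 m, t (j : ZMod N) = T at *
    generalize ∏ j ∈ Finset.Icc 1 m, b (j : ZMod N) = B at *
    have h1 := h12 (m + 1 : ℕ)
    have h2 := h13 (m + 1 : ℕ)
    have h3 := h13 m
    have h4 := ht (m + 1 : ℕ)
    have h5 := hb (m + 1 : ℕ)
    have hu : c03 (m : ZMod N) / c13 (m : ZMod N) =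
        t (m + 1 : ℕ) * c02 (m + 1 : ℕ) / (b (m + 1 : ℕ) * c12 (m + 1 : ℕ)) := by
      field_simp
      linear_combination -hx
    rw [hc] at hP
    rw [hu]
    generalize ((m + 1 : ℕ) : ZMod N) = k at *
    field_simp
    linear_combination t k * T * hP

/-- When the center coordinate is nonzero, the edge relation says that the total twisting
factors of the two sides agree. -/
lemma edge_relation_iff_prod_eq [NeZero N] (ht : ∀ k, t k ≠ 0) (hb : ∀ k, b k ≠ 0)
    (hPt : ∀ k, c03 k * c12 k + c01 k * c23 k = c02 k * c13 k)
    (hcross : ∀ k, t k * c02 k * c13 (k - 1) = b k * c12 k * c03 (k - 1))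
    (hid01 : ∀ k, c01 k = c01 (k - 1) * t k * b k)
    (h03 : ∀ k, c03 k ≠ 0) (h12 : ∀ k, c12 k ≠ 0) (h13 : ∀ k, c13 k ≠ 0) (h01 : c01 0 ≠ 0) :
    (∑ k ∈ Finset.range N,
        (c23 (k : ZMod N) / (c12 (k : ZMod N) * c13 (k : ZMod N))) *
          ∏ j ∈ Finset.Icc 1 k, (t (j : ZMod N)) ^ 2) = 0 ↔
      t 0 * ∏ j ∈ Finset.Icc 1 (N - 1), t (j : ZMod N) =
        b 0 * ∏ j ∈ Finset.Icc 1 (N - 1), b (j : ZMod N) := by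
  have hN : N - 1 + 1 = N := Nat.sub_add_cancel NeZero.one_le
  have hlast : ((N - 1 : ℕ) : ZMod N) = 0 - 1 := by
    rw [eq_sub_iff_add_eq, ← Nat.cast_add_one, hN, ZMod.natCast_self]
  have key := center_mul_partial_sum ht hb hPt hcross hid01 h12 h13 (N - 1)
  rw [hlast, hN] at key
  rw [← mul_eq_zero_iff_left h01, key]
  have hx := hcross 0
  have hT : ∏ j ∈ Finset.Icc 1 (N - 1), t (j : ZMod N) ≠ 0 :=
    Finset.prod_ne_zero_iff.mpr fun j _ => ht j
  have hB : ∏ j ∈ Finset.Icc 1 (N - 1), b (j : ZMod N) ≠ 0 :=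
    Finset.prod_ne_zero_iff.mpr fun j _ => hb j
  have h1 := h12 0
  have h2 := h13 (0 - 1)
  have h3 := h03 (0 - 1)
  have h4 := ht 0
  have hu : c02 0 / c12 0 = b 0 / t 0 * (c03 (0 - 1) / c13 (0 - 1)) := by
    field_simp
    linear_combination hx
  rw [hu, sub_eq_zero, mul_comm, mul_right_inj' (div_ne_zero h3 h2), div_eq_div_iff h4 hB]
  constructor <;> intro h <;> linear_combination -h

/-- When the center coordinate vanishes, the two edge sums are proportional. -/
lemma edge_sum_eq_of_center_eq_zero
    (hPt : ∀ k, c03 k * c12 k = c02 k * c13 k)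
    (hcross : ∀ k, t k * c02 k * c13 (k - 1) = b k * c12 k * c03 (k - 1))
    (h02 : ∀ k, c02 k ≠ 0) (h03 : ∀ k, c03 k ≠ 0)
    (h12 : ∀ k, c12 k ≠ 0) (h13 : ∀ k, c13 k ≠ 0) (n : ℕ) :
    (∑ k ∈ Finset.range n,
        (c23 (k : ZMod N) / (c12 (k : ZMod N) * c13 (k : ZMod N))) *
          ∏ j ∈ Finset.Icc 1 k, (t (j : ZMod N)) ^ 2) =
      (c03 0 / c13 0) ^ 2 * ∑ k ∈ Finset.range n,
        (c23 (k : ZMod N) / (c02 (k : ZMod N) * c03 (k : ZMod N))) *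
          ∏ j ∈ Finset.Icc 1 k, (b (j : ZMod N)) ^ 2 := by
  have hstep (k : ZMod N) : t k * c03 k * c13 (k - 1) = b k * c13 k * c03 (k - 1) := by
    apply mul_right_cancel₀ (h12 k)
    linear_combination t k * c13 (k - 1) * hPt k + c13 k * hcross k
  have hprod (m : ℕ) : c03 m * c13 0 * ∏ j ∈ Finset.Icc 1 m, t (j : ZMod N) =
      c13 m * c03 0 * ∏ j ∈ Finset.Icc 1 m, b (j : ZMod N) := by
    induction m with
    | zero => simp [mul_comm]
    | succ m ih =>
      rw [Finset.prod_Icc_succ_top (by omega), Finset.prod_Icc_succ_top (by omega)]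
      have hm : ((m + 1 : ℕ) : ZMod N) - 1 = m := by push_cast; ring
      have hs := hstep (m + 1 : ℕ)
      rw [hm] at hs
      apply mul_right_cancel₀ (h13 m)
      generalize ((m + 1 : ℕ) : ZMod N) = k at *
      generalize ∏ j ∈ Finset.Icc 1 m, t (j : ZMod N) = T at *
      linear_combination c13 0 * T * hs + b k * c13 k * ih
  rw [Finset.mul_sum]
  refine Finset.sum_congr rfl fun k _ => ?_
  rw [Finset.prod_pow, Finset.prod_pow]
  have hk := hprod k
  have h1 := h02 k
  have h2 := h03 k
  have h3 := h12 k
  have h4 := h13 k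
  have h5 := h13 0
  have hB : (∏ j ∈ Finset.Icc 1 k, t (j : ZMod N)) * (c03 k / c13 k) =
      c03 0 / c13 0 * ∏ j ∈ Finset.Icc 1 k, b (j : ZMod N) := by
    field_simp
    linear_combination hk
  have hc : c02 k = c03 k * c12 k / c13 k := by
    rw [eq_div_iff h4, hPt]
  rw [mul_left_comm, ← mul_pow, ← hB, hc]
  field_simp

end EdgeRelation


/-- **Enhanced edge relation equivalence.** For an enhanced Ptolemy assignment on the cyclic
complex `K` (with monomial twisting factors `t k`, `b k`, `h k` in the modified identification
relations), where the top and bottom Ptolemy coordinates are nonzero, the two enhanced edge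
relations around the center edge are equivalent. -/
theorem enhanced_edge_relations_equivalent (N : ℕ) [NeZero N]
    (t b h : ZMod N → ℂ)
    (c01 c02 c03 c12 c13 c23 : ZMod N → ℂ)
    (ht : ∀ k, t k ≠ 0) (hb : ∀ k, b k ≠ 0) (hh : ∀ k, h k ≠ 0)
    (hPt : ∀ k, c03 k * c12 k + c01 k * c23 k = c02 k * c13 k)
    (hid12 : ∀ k, c12 k = t k * h k * c13 (k - 1))
    (hid02 : ∀ k, c02 k = b k * h k * c03 (k - 1))
    (hid01 : ∀ k, c01 k = c01 (k - 1) * t k * b k)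
    (h02 : ∀ k, c02 k ≠ 0) (h03 : ∀ k, c03 k ≠ 0)
    (h12 : ∀ k, c12 k ≠ 0) (h13 : ∀ k, c13 k ≠ 0) :
    (∑ k ∈ Finset.range N,
        (c23 (k : ZMod N) / (c12 (k : ZMod N) * c13 (k : ZMod N))) *
          ∏ j ∈ Finset.Icc 1 k, (t (j : ZMod N)) ^ 2) = 0 ↔
      (∑ k ∈ Finset.range N,
        (c23 (k : ZMod N) / (c02 (k : ZMod N) * c03 (k : ZMod N))) *
          ∏ j ∈ Finset.Icc 1 k, (b (j : ZMod N)) ^ 2) = 0 := by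
  have hcross (k : ZMod N) : t k * c02 k * c13 (k - 1) = b k * c12 k * c03 (k - 1) := by
    rw [hid12, hid02]
    ring
  by_cases h01 : c01 0 = 0
  · have hPt' (k : ZMod N) : c03 k * c12 k = c02 k * c13 k := by
      have hk := center_coordinate_eq hid01 k.val
      rw [ZMod.natCast_zmod_val, h01, zero_mul, zero_mul] at hk
      simpa [hk] using hPt k
    rw [edge_sum_eq_of_center_eq_zero hPt' hcross h02 h03 h12 h13,
      mul_eq_zero_iff_left (pow_ne_zero 2 (div_ne_zero (h03 0) (h13 0)))]
  · have hswap := edge_relation_iff_prod_eq (c23 := fun k => -c23 k) hb ht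
      (fun k => by linear_combination -hPt k) (fun k => (hcross k).symm)
      (fun k => by linear_combination hid01 k) h13 h02 h03 h01
    simp only [neg_div, neg_mul, Finset.sum_neg_distrib, neg_eq_zero] at hswap
    rw [edge_relation_iff_prod_eq ht hb hPt hcross hid01 h03 h12 h13 h01, hswap, eq_comm]
end

section
/- Let g, h ∈ SL(2,ℂ) with g⁻¹h ∉ B, i.e. the left cosets gB and hB are distinct. Then there exists a unique pair (x₀, x₁) ∈ P × P such that the matrix (g·x₀)⁻¹·(h·x₁) is counterdiagonal (both diagonal entries equal 0). -/
/-- `B ⊂ SL(2,ℂ)`: the subgroup of upper triangular matrices. -/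
def InB (g : Matrix.SpecialLinearGroup (Fin 2) ℂ) : Prop :=
  (g : Matrix (Fin 2) (Fin 2) ℂ) 1 0 = 0

/-- `P ⊂ SL(2,ℂ)`: the subgroup of upper triangular matrices with `1`s on the diagonal. -/
def InP (g : Matrix.SpecialLinearGroup (Fin 2) ℂ) : Prop :=
  (g : Matrix (Fin 2) (Fin 2) ℂ) 1 0 = 0 ∧
    (g : Matrix (Fin 2) (Fin 2) ℂ) 0 0 = 1 ∧
    (g : Matrix (Fin 2) (Fin 2) ℂ) 1 1 = 1

/-- A matrix is counterdiagonal if both diagonal entries vanish. -/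
def Counterdiagonal (g : Matrix.SpecialLinearGroup (Fin 2) ℂ) : Prop :=
  (g : Matrix (Fin 2) (Fin 2) ℂ) 0 0 = 0 ∧ (g : Matrix (Fin 2) (Fin 2) ℂ) 1 1 = 0

/-- The unipotent upper triangular matrix with upper right entry `s`. -/
def upperUnipotent (s : ℂ) : Matrix.SpecialLinearGroup (Fin 2) ℂ :=
  ⟨!![1, s; 0, 1], by simp⟩

theorem coe_upperUnipotent (s : ℂ) :
    (upperUnipotent s : Matrix (Fin 2) (Fin 2) ℂ) = !![1, s; 0, 1] :=
  rfl

theorem inP_upperUnipotent (s : ℂ) : InP (upperUnipotent s) := by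
  simp [InP, coe_upperUnipotent]

theorem InP.eq_upperUnipotent {x : Matrix.SpecialLinearGroup (Fin 2) ℂ} (hx : InP x) :
    x = upperUnipotent (x 0 1) := by
  obtain ⟨h10, h00, h11⟩ := hx
  ext i j
  fin_cases i <;> fin_cases j <;> simp [coe_upperUnipotent, h10, h00, h11]

theorem counterdiagonal_upperUnipotent_iff {m : Matrix.SpecialLinearGroup (Fin 2) ℂ}
    (hm : ¬ InB m) (s t : ℂ) :
    Counterdiagonal ((upperUnipotent s)⁻¹ * m * upperUnipotent t) ↔
      s = m 0 0 / m 1 0 ∧ t = -m 1 1 / m 1 0 := by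
  have hc : m 1 0 ≠ 0 := hm
  rw [eq_div_iff hc, eq_div_iff hc]
  simp only [Counterdiagonal, Matrix.SpecialLinearGroup.coe_mul,
    Matrix.SpecialLinearGroup.coe_inv, coe_upperUnipotent, Matrix.adjugate_fin_two_of,
    Matrix.mul_apply, Fin.sum_univ_two, Matrix.of_apply, Matrix.cons_val', Matrix.cons_val_zero,
    Matrix.cons_val_one, Matrix.cons_val_fin_one]
  constructor <;> rintro ⟨h₁, h₂⟩ <;> constructor <;> grind

/-- **Bruhat lemma, generic case.** If the cosets `gB` and `hB` are distinct, there exist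
unique coset representatives `g * x₀` and `h * x₁` (with `x₀, x₁ ∈ P`) such that
`(g * x₀)⁻¹ * (h * x₁)` is counterdiagonal. -/
theorem bruhat_unique_counterdiagonal (g h : Matrix.SpecialLinearGroup (Fin 2) ℂ)
    (hgh : ¬ InB (g⁻¹ * h)) :
    ∃! p : Matrix.SpecialLinearGroup (Fin 2) ℂ × Matrix.SpecialLinearGroup (Fin 2) ℂ,
      InP p.1 ∧ InP p.2 ∧ Counterdiagonal ((g * p.1)⁻¹ * (h * p.2)) := by
  have key : ∀ s t : ℂ, Counterdiagonal ((g * upperUnipotent s)⁻¹ * (h * upperUnipotent t)) ↔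
      s = (g⁻¹ * h) 0 0 / (g⁻¹ * h) 1 0 ∧ t = -(g⁻¹ * h) 1 1 / (g⁻¹ * h) 1 0 := by
    intro s t
    rw [← counterdiagonal_upperUnipotent_iff hgh, mul_inv_rev]
    simp only [mul_assoc]
  refine ⟨(upperUnipotent _, upperUnipotent _),
    ⟨inP_upperUnipotent _, inP_upperUnipotent _, (key _ _).2 ⟨rfl, rfl⟩⟩, ?_⟩
  rintro ⟨x, y⟩ ⟨hx, hy, hxy⟩
  dsimp only at hx hy hxy
  rw [hx.eq_upperUnipotent, hy.eq_upperUnipotent, key] at hxy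
  rw [hx.eq_upperUnipotent, hy.eq_upperUnipotent, hxy.1, hxy.2]
end

section
/- Let c₀₁, c₀₂, c₀₃, c₁₂, c₁₃, c₂₃ be complex numbers with c₀₁ ≠ 0, c₁₂ ≠ 0, c₂₃ ≠ 0, satisfying the Ptolemy relation c₀₃·c₁₂ + c₀₁·c₂₃ = c₀₂·c₁₃. Define g₀ = I, g₁ = q(c₀₁), g₂ = g₁·x(c₀₂/(c₀₁·c₁₂))·q(c₁₂), and g₃ = g₂·x(c₁₃/(c₁₂·c₂₃))·q(c₂₃) in SL(2,ℂ). Then det(g_i·e₁, g_j·e₁) = c_{ij} for all 0 ≤ i < j ≤ 3. -/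
/-- The determinant of the `2 × 2` matrix with columns `v` and `w`. -/
noncomputable def det2 (v w : Fin 2 → ℂ) : ℂ :=
  Matrix.det !![v 0, w 0; v 1, w 1]

/-- `x(a) = [[1, a], [0, 1]]`. -/
def xMat (a : ℂ) : Matrix (Fin 2) (Fin 2) ℂ := !![1, a; 0, 1]

/-- `q(b) = [[0, -b⁻¹], [b, 0]]`. -/
noncomputable def qMat (b : ℂ) : Matrix (Fin 2) (Fin 2) ℂ := !![0, -b⁻¹; b, 0]

/-- **Recovering a decoration from a Ptolemy assignment with at most one vanishing coordinate
per face.** If `c₀₁, c₁₂, c₂₃ ≠ 0` and the Ptolemy relation holds, then the explicit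
decoration `g₀ = I`, `g₁ = q(c₀₁)`, `g₂ = g₁·x(c₀₂/(c₀₁c₁₂))·q(c₁₂)`,
`g₃ = g₂·x(c₁₃/(c₁₂c₂₃))·q(c₂₃)` has Ptolemy coordinates `det(g_i·e₁, g_j·e₁) = c_{ij}`. -/
theorem decoration_realizing_ptolemy_assignment
    (c01 c02 c03 c12 c13 c23 : ℂ)
    (h01 : c01 ≠ 0) (h12 : c12 ≠ 0) (h23 : c23 ≠ 0)
    (hPt : c03 * c12 + c01 * c23 = c02 * c13)
    (g₀ g₁ g₂ g₃ : Matrix (Fin 2) (Fin 2) ℂ)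
    (hg₀ : g₀ = 1)
    (hg₁ : g₁ = qMat c01)
    (hg₂ : g₂ = g₁ * xMat (c02 / (c01 * c12)) * qMat c12)
    (hg₃ : g₃ = g₂ * xMat (c13 / (c12 * c23)) * qMat c23) :
    det2 (g₀.mulVec ![1, 0]) (g₁.mulVec ![1, 0]) = c01 ∧
    det2 (g₀.mulVec ![1, 0]) (g₂.mulVec ![1, 0]) = c02 ∧
    det2 (g₀.mulVec ![1, 0]) (g₃.mulVec ![1, 0]) = c03 ∧
    det2 (g₁.mulVec ![1, 0]) (g₂.mulVec ![1, 0]) = c12 ∧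
    det2 (g₁.mulVec ![1, 0]) (g₃.mulVec ![1, 0]) = c13 ∧
    det2 (g₂.mulVec ![1, 0]) (g₃.mulVec ![1, 0]) = c23 := by
  have hv₀ : g₀.mulVec ![1, 0] = ![1, 0] := by simp [hg₀]
  have hv₁ : g₁.mulVec ![1, 0] = ![0, c01] := by
    ext i
    fin_cases i <;> simp [hg₁, qMat]
  have hg₂' : g₂ = !![-c12 / c01, 0; c02, -c01 / c12] := by
    rw [hg₂, hg₁]
    ext i j
    fin_cases i <;> fin_cases j <;> simp [qMat, xMat] <;> field_simp
  have hv₂ : g₂.mulVec ![1, 0] = ![-c12 / c01, c02] := by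
    ext i
    fin_cases i <;> simp [hg₂']
  have hv₃ : g₃.mulVec ![1, 0] = ![-c13 / c01, c03] := by
    rw [hg₃, hg₂']
    ext i
    fin_cases i
    · simp [qMat, xMat]
      field_simp
    · simp [qMat, xMat]
      field_simp
      linear_combination -hPt
  rw [hv₀, hv₁, hv₂, hv₃]
  simp only [det2, Matrix.det_fin_two_of, Matrix.cons_val_zero, Matrix.cons_val_one]
  refine ⟨by ring, by ring, by ring, by field_simp; ring, by field_simp; ring, ?_⟩
  field_simp
  linear_combination -hPt
end

section
/- The only complex solution (x, y, z) ∈ ℂ³ of the system z² − x² = z·y, x² − y² = −z², z² − x² = −z·y is x = y = z = 0. -/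
/-- The Ptolemy relations of the `SL(2,ℂ)` Ptolemy variety of the census triangulation of
`m009` have only the trivial solution: the Ptolemy variety (for the trivial obstruction
class) is empty. -/
theorem m009_SL2_ptolemy_only_trivial_solution (x y z : ℂ) :
    (z ^ 2 - x ^ 2 = z * y ∧ x ^ 2 - y ^ 2 = -z ^ 2 ∧ z ^ 2 - x ^ 2 = -(z * y)) ↔
      (x = 0 ∧ y = 0 ∧ z = 0) := by
  constructor
  · rintro ⟨h₁, h₂, h₃⟩
    have hzy : z * y = 0 := by linear_combination (h₃ - h₁) / 2
    have hy : y ^ 2 = 2 * z ^ 2 := by linear_combination -h₂ - h₁ - hzy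
    have hz : z = 0 := by
      refine pow_eq_zero_iff (n := 4) (by norm_num) |>.mp ?_
      linear_combination z * y / 2 * hzy - z ^ 2 / 2 * hy
    subst hz
    have hx : x ^ 2 = 0 := by linear_combination -h₁
    exact ⟨by simpa using hx, by simpa using hy, rfl⟩
  · rintro ⟨rfl, rfl, rfl⟩
    norm_num
end

section
/- Let m, l, x, y ∈ ℂ with m ≠ 0, l ≠ 0, x ≠ 0, and suppose that (with z = 1) the equations m − l·x² − m²·y = 0, m²·l·y² − l·x² − m³ = 0, m⁵ − l·x² + m³·l·y = 0, and m² + m²·l·y + m·l − l·y = 0 all hold. Then m⁶·l − 2·m⁴·l − m³·l² − m³ − 2·m²·l + l = 0. -/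
/-- The enhanced Ptolemy relations of `m009` (with `z = 1`) together with the edge relation
around edge 2 imply that the eigenvalue coordinates `(m, l)` lie on the zero set of the
`A`-polynomial `A(m, l) = m⁶l − 2m⁴l − m³l² − m³ − 2m²l + l` of `m009`. -/
theorem m009_enhanced_ptolemy_implies_A_polynomial (m l x y : ℂ)
    (hm : m ≠ 0) (hl : l ≠ 0) (hx : x ≠ 0)
    (h1 : m - l * x ^ 2 - m ^ 2 * y = 0)
    (h2 : m ^ 2 * l * y ^ 2 - l * x ^ 2 - m ^ 3 = 0)
    (h3 : m ^ 5 - l * x ^ 2 + m ^ 3 * l * y = 0)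
    (h4 : m ^ 2 + m ^ 2 * l * y + m * l - l * y = 0) :
    m ^ 6 * l - 2 * m ^ 4 * l - m ^ 3 * l ^ 2 - m ^ 3 - 2 * m ^ 2 * l + l = 0 := by
  -- Eliminate `x`, cancel powers of `m`, and express the result through `m * y`.
  have hly : m ^ 4 - 1 + m * y + m ^ 2 * l * y = 0 :=
    mul_left_cancel₀ hm (by linear_combination h3 - h1)
  have hquad : (m * y) ^ 2 - (1 + m ^ 2 - m ^ 4) * (m * y) + m ^ 2 + m ^ 4 = 0 := by
    linear_combination m * y * hly - m * h2 + m * h1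
  have hL : m ^ 3 * l = (m * y - 1 + m ^ 4) * (m ^ 2 - 1) - m ^ 4 := by
    linear_combination m ^ 2 * h4 - (m ^ 2 - 1) * hly
  refine mul_left_cancel₀ (pow_ne_zero 3 hm) ?_
  linear_combination
    (m ^ 6 - 2 * m ^ 4 - 2 * m ^ 2 + 1 - m ^ 3 * l
      - ((m * y - 1 + m ^ 4) * (m ^ 2 - 1) - m ^ 4)) * hL - (m ^ 2 - 1) ^ 2 * hquad
end

section
/- Let m, l, y, z ∈ ℂ with m ≠ 0 and l ≠ 0, and suppose (setting x = 0) that m·z² − m²·y·z = 0, m²·l·y² − m³·z² = 0, and m⁵·z² + m³·l·y·z = 0. Then y = 0 and z = 0; that is, the enhanced Ptolemy relations of m009 have no nontrivial solutions with x = 0. -/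
/-- The enhanced Ptolemy relations of `m009` specialized at `x = 0` have no nontrivial
solutions: they force `y = 0` and `z = 0`. -/
theorem m009_enhanced_ptolemy_no_solution_with_x_zero (m l y z : ℂ)
    (hm : m ≠ 0) (hl : l ≠ 0)
    (h1 : m * z ^ 2 - m ^ 2 * y * z = 0)
    (h2 : m ^ 2 * l * y ^ 2 - m ^ 3 * z ^ 2 = 0)
    (h3 : m ^ 5 * z ^ 2 + m ^ 3 * l * y * z = 0) :
    y = 0 ∧ z = 0 := by
  have hz : z = 0 := by
    by_contra hz
    have hzy : z = m * y := by
      have h : m * z * (z - m * y) = 0 := by linear_combination h1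
      exact sub_eq_zero.mp ((mul_eq_zero.mp h).resolve_left (mul_ne_zero hm hz))
    subst hzy
    have hy : y ≠ 0 := right_ne_zero_of_mul hz
    have hl_pos : l - m ^ 3 = 0 := by
      have h : m ^ 2 * y ^ 2 * (l - m ^ 3) = 0 := by linear_combination h2
      exact (mul_eq_zero.mp h).resolve_left (by simp [hm, hy])
    have hl_neg : m ^ 3 + l = 0 := by
      have h : m ^ 4 * y ^ 2 * (m ^ 3 + l) = 0 := by linear_combination h3
      exact (mul_eq_zero.mp h).resolve_left (by simp [hm, hy])
    exact hl (by linear_combination (hl_pos + hl_neg) / 2)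
  subst hz
  have h : m ^ 2 * l * y ^ 2 = 0 := by linear_combination h2
  simpa [hm, hl] using h
end

section
/- Let N ≥ 1, let d₀, …, d_{N−1} ∈ ℂ, and let t₁, …, t_N ∈ ℂ be nonzero with ∏_{j=1}^{N} t_j = 1. Then the product ∏_{k=0}^{N−1} x(d_k)·d(t_{k+1}) of 2×2 matrices (taken in order of increasing k) equals the identity matrix if and only if ∑_{k=0}^{N−1} d_k·∏_{j=1}^{k} t_j² = 0. -/
/-- `d(t) = [[t, 0], [0, t⁻¹]]`. -/
noncomputable def dMat (t : ℂ) : Matrix (Fin 2) (Fin 2) ℂ := !![t, 0; 0, t⁻¹]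

/-- The ordered product of the matrices `x(d_k)·d(t_{k+1})` is upper triangular, with the partial
products of the `t_j` on the diagonal and the enhanced edge sum off the diagonal. -/
theorem prod_xMat_mul_dMat (N : ℕ) (d t : ℕ → ℂ) (ht : ∀ j ∈ Finset.Icc 1 N, t j ≠ 0) :
    ((List.range N).map (fun k => xMat (d k) * dMat (t (k + 1)))).prod =
      !![∏ j ∈ Finset.Icc 1 N, t j,
          (∏ j ∈ Finset.Icc 1 N, t j)⁻¹ *
            ∑ k ∈ Finset.range N, d k * ∏ j ∈ Finset.Icc 1 k, (t j) ^ 2;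
        0, (∏ j ∈ Finset.Icc 1 N, t j)⁻¹] := by
  induction N with
  | zero => simp [Matrix.one_fin_two]
  | succ n ih =>
    have ht' : ∀ j ∈ Finset.Icc 1 n, t j ≠ 0 := fun j hj =>
      ht j (Finset.Icc_subset_Icc_right n.le_succ hj)
    have hT : ∏ j ∈ Finset.Icc 1 n, t j ≠ 0 := Finset.prod_ne_zero_iff.mpr ht'
    have htn : t (n + 1) ≠ 0 := ht (n + 1) (by simp)
    rw [List.range_succ, List.map_append, List.prod_append, ih ht',
      Finset.prod_Icc_succ_top (by lia), Finset.sum_range_succ, Finset.prod_pow]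
    simp only [xMat, dMat, List.map_cons, List.map_nil, List.prod_singleton, Matrix.mul_fin_two]
    ext i j
    fin_cases i <;> fin_cases j <;> simp <;> field_simp
    ring

/-- **Geometric meaning of the enhanced edge relation.** For `d₀, …, d_{N−1} ∈ ℂ` and nonzero
`t₁, …, t_N` with `∏_{j=1}^{N} t_j = 1`, the ordered product
`∏_{k=0}^{N−1} x(d_k)·d(t_{k+1})` is the identity matrix if and only if
`∑_{k=0}^{N−1} d_k·∏_{j=1}^{k} t_j² = 0`. -/
theorem fattened_cocycle_product_eq_one_iff_enhanced_edge_relation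
    (N : ℕ) (hN : 1 ≤ N) (d t : ℕ → ℂ)
    (ht : ∀ j ∈ Finset.Icc 1 N, t j ≠ 0)
    (htprod : ∏ j ∈ Finset.Icc 1 N, t j = 1) :
    ((List.range N).map (fun k => xMat (d k) * dMat (t (k + 1)))).prod = 1 ↔
      ∑ k ∈ Finset.range N, d k * ∏ j ∈ Finset.Icc 1 k, (t j) ^ 2 = 0 := by
  rw [prod_xMat_mul_dMat N d t ht, htprod, Matrix.one_fin_two]
  simp
end
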